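/- Let V : ℝ × ℝ^n → ℝ be continuously differentiable, γ ∈ ℝ, T_s > 0, E₀ ⊆ {e : V(0,e) ≤ γ}, and let O ⊆ ℝ^n be a set containing the union ⋃_{t ∈ [0, T_s)} {e : V(t, e) ≤ γ}. Suppose (i) for all t ∈ [0, T_s), e, x̂, û, w with V(t, e) = γ, x̂ ∈ X̂, û ∈ Û, w ∈ W: ∂V/∂t + ∂V/∂e · ( f_e(e, x̂, û, w) + g_e(e, x̂, û, w) κ(t, e, x̂, û) ) < 0; and (ii) V(0, h(e, x̂, û, Δû)) ≤ γ for all x̂ ∈ X̂, û ∈ Û, Δû ∈ ΔÛ and all e with V(T_s, e) ≤ γ. Consider the hybrid error trajectory e : [0,∞) → ℝ^n that on each interval [τ_k, τ_{k+1}) with τ_k = k·T_s is differentiable and satisfies e'(t) = f_e(e(t), x̂(t), û(t), w(t)) + g_e(e(t), x̂(t), û(t), w(t)) · κ(t mod T_s, e(t), x̂(t), û(t)), and at each sampling instant τ_{k+1} jumps according to e(τ_{k+1}) = h(e(τ_{k+1}⁻), x̂(τ_{k+1}⁻), û(τ_{k+1}⁻), Δû(τ_{k+1})), where x̂(t) ∈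 X̂, û(t) ∈ Û, Δû(τ_k) ∈ ΔÛ, w(t) ∈ W for all t. Then e(0) ∈ E₀ implies e(t) ∈ O for all t ≥ 0; moreover, for each k ≥ 0 and t̃ ∈ [0, T_s), V(t̃, e(k·T_s + t̃)) ≤ γ. -/

import Mathlib

open Set

/-- The time derivative of `V` along a moving point splits into the partial derivatives of `V`. -/
theorem hasDerivWithinAt_comp_partial {E : Type*} [NormedAddCommGroup E] [NormedSpace ℝ E]
    {V : ℝ → E → ℝ} (hV : Differentiable ℝ (fun pr : ℝ × E => V pr.1 pr.2))
    {e : ℝ → E} {v : E} {a t : ℝ} {S : Set ℝ} (he : HasDerivWithinAt e v S t) :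
    HasDerivWithinAt (fun s => V (s - a) (e s))
      (deriv (fun s => V s (e t)) (t - a) + fderiv ℝ (V (t - a)) (e t) v) S t := by
  have hL := (hV (t - a, e t)).hasFDerivAt
  set L := fderiv ℝ (fun pr : ℝ × E => V pr.1 pr.2) (t - a, e t)
  have htime : HasDerivAt (fun s => V s (e t)) (L (1, 0)) (t - a) :=
    HasFDerivAt.comp_hasDerivAt (f := fun s => (s, e t)) (t - a) hL
      ((hasDerivAt_id (t - a)).prodMk (hasDerivAt_const (t - a) (e t)))
  have hspace : HasFDerivAt (V (t - a)) (L.comp (ContinuousLinearMap.inr ℝ ℝ E)) (e t) :=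
    hL.comp (e t) (hasFDerivAt_prodMk_right (t - a) (e t))
  have hpath : HasDerivWithinAt (fun s => V (s - a) (e s)) (L (1, v)) S t :=
    HasFDerivAt.comp_hasDerivWithinAt (f := fun s => (s - a, e s)) t hL
      (((hasDerivWithinAt_id t S).sub_const a).prodMk he)
  rw [htime.deriv, hspace.fderiv]
  convert hpath using 1
  simp [← map_add]

/-- Strict decrease of `V` on the level set `γ` makes the funnel `V ≤ γ` invariant along a flow. -/
theorem funnel_invariant {E : Type*} [NormedAddCommGroup E] [NormedSpace ℝ E]
    {V : ℝ → E → ℝ} (hV : Differentiable ℝ (fun pr : ℝ × E => V pr.1 pr.2))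
    {γ a b : ℝ} {e e' : ℝ → E}
    (he : ∀ t ∈ Ico a b, HasDerivWithinAt e (e' t) (Ico a b) t)
    (h0 : V 0 (e a) ≤ γ)
    (hdecr : ∀ t ∈ Ico a b, V (t - a) (e t) = γ →
      deriv (fun s => V s (e t)) (t - a) + fderiv ℝ (V (t - a)) (e t) (e' t) < 0) :
    ∀ t ∈ Ico a b, V (t - a) (e t) ≤ γ := by
  intro t ht
  have hd : ∀ s ∈ Ico a b, HasDerivWithinAt (fun s => V (s - a) (e s))
      (deriv (fun r => V r (e s)) (s - a) + fderiv ℝ (V (s - a)) (e s) (e' s)) (Ico a b) s :=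
    fun s hs => hasDerivWithinAt_comp_partial hV (he s hs)
  have hsub : ∀ s ∈ Icc a t, s ∈ Ico a b := fun s hs => ⟨hs.1, hs.2.trans_lt ht.2⟩
  refine image_le_of_deriv_right_lt_deriv_boundary (f := fun s => V (s - a) (e s))
    (a := a) (b := t) (B := fun _ => γ) (B' := fun _ => 0)
    (fun s hs => ((hd s (hsub s hs)).continuousWithinAt).mono hsub)
    (fun s hs => (hd s (hsub s (Ico_subset_Icc_self hs))).mono_of_mem_nhdsWithin ?_)
    (by simpa using h0) (fun s => hasDerivAt_const s γ)
    (fun s hs => hdecr s (hsub s (Ico_subset_Icc_self hs))) ⟨ht.1, le_rfl⟩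
  exact Filter.mem_of_superset (Ico_mem_nhdsGE (hs.2.trans ht.2)) (Ico_subset_Ico_left hs.1)

/-- **Theorem 2** (boundedness of the tracking error for all time). Combining within-sample
funnel invariance (Proposition 1) and across-sample jump containment (Proposition 2): for
a hybrid error trajectory flowing on each sampling interval `[kT_s, (k+1)T_s)` under the
time-varying feedback `κ(t mod T_s, ⋅)` and jumping via the jump function `h` at each
sampling instant, if `e(0) ∈ E₀` then `e(t) ∈ O` for all `t ≥ 0`, where `O` contains the
union of the funnel slices `⋃_{t̃ ∈ [0,T_s)} Ω(V, t̃, γ)`; moreover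
`V(t̃, e(kT_s + t̃)) ≤ γ` for every `k` and `t̃ ∈ [0,T_s)`. -/
theorem thm2_TEB
    {n m p q r : ℕ}
    (V : ℝ → (Fin n → ℝ) → ℝ)
    (hV : ContDiff ℝ 1 (fun pr : ℝ × (Fin n → ℝ) => V pr.1 pr.2))
    (γ Ts : ℝ) (hTs : 0 < Ts)
    (Xh : Set (Fin m → ℝ)) (Uh : Set (Fin p → ℝ)) (ΔUh : Set (Fin p → ℝ))
    (W : Set (Fin q → ℝ))
    (E0 : Set (Fin n → ℝ)) (hE0 : E0 ⊆ {e | V 0 e ≤ γ})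
    (O : Set (Fin n → ℝ)) (hO : (⋃ t ∈ Ico (0:ℝ) Ts, {e | V t e ≤ γ}) ⊆ O)
    (fe : (Fin n → ℝ) → (Fin m → ℝ) → (Fin p → ℝ) → (Fin q → ℝ) → (Fin n → ℝ))
    (ge : (Fin n → ℝ) → (Fin m → ℝ) → (Fin p → ℝ) → (Fin q → ℝ) →
      Matrix (Fin n) (Fin r) ℝ)
    (κ : ℝ → (Fin n → ℝ) → (Fin m → ℝ) → (Fin p → ℝ) → (Fin r → ℝ))
    (h : (Fin n → ℝ) → (Fin m → ℝ) → (Fin p → ℝ) → (Fin p → ℝ) → (Fin n → ℝ))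
    -- (i) within-sample strict decrease condition on the level set (Proposition 1)
    (hdecr : ∀ t ∈ Ico (0:ℝ) Ts,
      ∀ (e : Fin n → ℝ) (xh : Fin m → ℝ) (uh : Fin p → ℝ) (w : Fin q → ℝ),
      V t e = γ → xh ∈ Xh → uh ∈ Uh → w ∈ W →
      deriv (fun s => V s e) t
        + fderiv ℝ (V t) e
            (fe e xh uh w + (ge e xh uh w).mulVec (κ t e xh uh)) < 0)
    -- (ii) across-sample jump containment condition (Proposition 2)
    (hjumpcond : ∀ (e : Fin n → ℝ) (xh : Fin m → ℝ) (uh Δuh : Fin p → ℝ),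
      xh ∈ Xh → uh ∈ Uh → Δuh ∈ ΔUh → V Ts e ≤ γ → V 0 (h e xh uh Δuh) ≤ γ)
    -- hybrid trajectory and exogenous signals
    (e : ℝ → (Fin n → ℝ)) (xh : ℝ → (Fin m → ℝ)) (uh : ℝ → (Fin p → ℝ))
    (w : ℝ → (Fin q → ℝ)) (Δuh : ℕ → (Fin p → ℝ))
    (eMinus : ℕ → (Fin n → ℝ))
    (hxhmem : ∀ t : ℝ, 0 ≤ t → xh t ∈ Xh)
    (huhmem : ∀ t : ℝ, 0 ≤ t → uh t ∈ Uh)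
    (hwmem : ∀ t : ℝ, 0 ≤ t → w t ∈ W)
    (hΔuhmem : ∀ k : ℕ, Δuh k ∈ ΔUh)
    -- the planner state is continuous and the planner input is zero-order-hold
    (hxhcont : Continuous xh)
    (hzoh : ∀ k : ℕ, ∀ t ∈ Ico ((k : ℝ) * Ts) (((k : ℝ) + 1) * Ts), uh t = uh ((k : ℝ) * Ts))
    -- flow on each sampling interval, with feedback evaluated at `t mod T_s = t - kT_s`
    (hflow : ∀ k : ℕ, ∀ t ∈ Ico ((k : ℝ) * Ts) (((k : ℝ) + 1) * Ts),
      HasDerivWithinAt e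
        (fe (e t) (xh t) (uh t) (w t)
          + (ge (e t) (xh t) (uh t) (w t)).mulVec
              (κ (t - (k : ℝ) * Ts) (e t) (xh t) (uh t)))
        (Ico ((k : ℝ) * Ts) (((k : ℝ) + 1) * Ts)) t)
    -- `eMinus k` is the left limit `e(τ_{k+1}⁻)` of the trajectory at `τ_{k+1}`
    (hlim : ∀ k : ℕ,
      Filter.Tendsto e (nhdsWithin (((k : ℝ) + 1) * Ts) (Iio (((k : ℝ) + 1) * Ts)))
        (nhds (eMinus k)))
    -- jump at each sampling instant `τ_{k+1}` via the jump function `h`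
    (hjump : ∀ k : ℕ,
      e (((k : ℝ) + 1) * Ts)
        = h (eMinus k) (xh (((k : ℝ) + 1) * Ts)) (uh ((k : ℝ) * Ts)) (Δuh (k + 1)))
    (he0 : e 0 ∈ E0) :
    (∀ t : ℝ, 0 ≤ t → e t ∈ O) ∧
    (∀ k : ℕ, ∀ t' ∈ Ico (0:ℝ) Ts, V t' (e ((k : ℝ) * Ts + t')) ≤ γ) := by
  have hflowle : ∀ k : ℕ, V 0 (e ((k : ℝ) * Ts)) ≤ γ →
      ∀ t ∈ Ico ((k : ℝ) * Ts) (((k : ℝ) + 1) * Ts), V (t - k * Ts) (e t) ≤ γ := by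
    intro k h0
    refine funnel_invariant (hV.differentiable one_ne_zero) (hflow k) h0 fun t ht hγ => ?_
    have ht0 : 0 ≤ t := le_trans (by positivity) ht.1
    exact hdecr _ ⟨by linarith [ht.1], by linarith [ht.2]⟩ _ _ _ _ hγ
      (hxhmem t ht0) (huhmem t ht0) (hwmem t ht0)
  have hstart : ∀ k : ℕ, V 0 (e ((k : ℝ) * Ts)) ≤ γ := by
    intro k
    induction k with
    | zero => simpa using hE0 he0
    | succ k ih =>
      have hlt : (k : ℝ) * Ts < ((k : ℝ) + 1) * Ts := by linarith
      have htend : Filter.Tendsto (fun t => V (t - k * Ts) (e t))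
          (nhdsWithin (((k : ℝ) + 1) * Ts) (Iio (((k : ℝ) + 1) * Ts)))
          (nhds (V ((k + 1) * Ts - k * Ts) (eMinus k))) :=
        (hV.continuous.tendsto ((k + 1) * Ts - k * Ts, eMinus k)).comp
          ((((continuous_id.sub continuous_const).tendsto _).mono_left
            nhdsWithin_le_nhds).prodMk_nhds (hlim k))
      have hle := le_of_tendsto htend
        (Filter.mem_of_superset (Ico_mem_nhdsLT hlt) (hflowle k ih))
      rw [show ((k : ℝ) + 1) * Ts - k * Ts = Ts by ring] at hle
      push_cast
      rw [hjump k]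
      exact hjumpcond _ _ _ _ (hxhmem _ (by positivity)) (huhmem _ (by positivity))
        (hΔuhmem _) hle
  have hmain : ∀ k : ℕ, ∀ t' ∈ Ico (0:ℝ) Ts, V t' (e ((k : ℝ) * Ts + t')) ≤ γ := by
    intro k t' ht'
    simpa using hflowle k (hstart k) (k * Ts + t') ⟨by linarith [ht'.1], by linarith [ht'.2]⟩
  refine ⟨fun t ht => ?_, hmain⟩
  have hfloor := (le_div_iff₀ hTs).1 (Nat.floor_le (div_nonneg ht hTs.le))
  have hceil := (div_lt_iff₀ hTs).1 (Nat.lt_floor_add_one (t / Ts))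
  have hmem : t - ⌊t / Ts⌋₊ * Ts ∈ Ico (0:ℝ) Ts := ⟨by linarith, by linarith⟩
  exact hO (mem_biUnion hmem (by simpa using hmain ⌊t / Ts⌋₊ _ hmem))
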